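/- In the iidpnmrv setup with E^*[|X₁|] < ∞, assume E_*[X₁] < E^*[X₁]. Then the set {ω ∈ Ω : lim_{n→∞} Sₙ(ω)/n exists} is maximally nonmeasurable: every P-measurable subset of it has P-measure 0 and every P-measurable superset of it has P-measure 1. -/

import Mathlib

open MeasureTheory Filter Topology

/-- `flow` is a maximal measurable minorant of `f` with respect to the measure `P`. -/
def IsMeasMinorant {Ω : Type*} [MeasurableSpace Ω] (P : Measure Ω) (f flow : Ω → ℝ) : Prop :=
  Measurable flow ∧ (∀ ω, flow ω ≤ f ω) ∧
    ∀ g : Ω → ℝ, Measurable g → (∀ ω, g ω ≤ f ω) → ∀ᵐ ω ∂P, g ω ≤ flow ω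

/-- `fup` is a minimal measurable majorant of `f` with respect to the measure `P`. -/
def IsMeasMajorant {Ω : Type*} [MeasurableSpace Ω] (P : Measure Ω) (f fup : Ω → ℝ) : Prop :=
  Measurable fup ∧ (∀ ω, f ω ≤ fup ω) ∧
    ∀ h : Ω → ℝ, Measurable h → (∀ ω, f ω ≤ h ω) → ∀ᵐ ω ∂P, fup ω ≤ h ω

open ProbabilityTheory

/-- A set of full outer measure carries a measure which pushes forward to the ambient one. -/
lemma exists_measure_subtype_map_val_eq {α : Type*} [MeasurableSpace α] (μ : Measure α)
    [IsProbabilityMeasure μ] {A : Set α} (hA : μ A = 1) :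
    ∃ ν : Measure A, IsProbabilityMeasure ν ∧ ν.map Subtype.val = μ := by
  let m : OuterMeasure A := OuterMeasure.comap Subtype.val μ.toOuterMeasure
  have hm (s : Set A) : m s = μ (Subtype.val '' s) := rfl
  have hle : (inferInstance : MeasurableSpace A) ≤ m.caratheodory := by
    rintro s ⟨C, hC, rfl⟩
    rw [OuterMeasure.isCaratheodory_iff]
    intro t
    rw [hm, hm, hm, Set.image_inter_preimage, ← measure_inter_add_sdiff (Subtype.val '' t) hC]
    congr 2
    ext x
    simp only [Set.mem_sdiff, Set.mem_image, Set.mem_preimage, Subtype.exists]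
    grind
  have hmap : (m.toMeasure hle).map Subtype.val = μ := by
    have hres : μ.restrict A = μ := by
      rw [← Measure.restrict_toMeasurable (measure_ne_top μ A)]
      exact Measure.restrict_eq_self_of_ae_mem
        ((mem_ae_iff_prob_eq_one (measurableSet_toMeasurable μ A)).2 (by simp [hA]))
    ext C hC
    rw [Measure.map_apply measurable_subtype_coe hC,
      toMeasure_apply _ _ (measurable_subtype_coe hC), hm, Subtype.image_preimage_coe,
      Set.inter_comm, ← Measure.restrict_apply hC, hres]
  refine ⟨m.toMeasure hle, ⟨?_⟩, hmap⟩
  rw [← Set.preimage_univ (f := (Subtype.val : A → α)),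
    ← Measure.map_apply measurable_subtype_coe MeasurableSet.univ, hmap, measure_univ]

/-- A product of sets of full outer measure has full outer measure. -/
lemma infinitePi_univ_pi_eq_one {ι : Type*} {α : ι → Type*} [∀ i, MeasurableSpace (α i)]
    (μ : ∀ i, Measure (α i)) [∀ i, IsProbabilityMeasure (μ i)] {A : ∀ i, Set (α i)}
    (hA : ∀ i, μ i (A i) = 1) : Measure.infinitePi μ (Set.univ.pi A) = 1 := by
  choose ν hν hmap using fun i => exists_measure_subtype_map_val_eq (μ i) (hA i)
  have hpi := Measure.infinitePi_map_pi ν (f := fun i => (Subtype.val : A i → α i))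
    (fun i => measurable_subtype_coe)
  simp only [hmap] at hpi
  refine le_antisymm prob_le_one ?_
  rw [← measure_toMeasurable, ← hpi, Measure.map_apply (by fun_prop)
    (measurableSet_toMeasurable _ _)]
  rw [← measure_univ (μ := Measure.infinitePi ν)]
  refine measure_mono fun x _ => ?_
  exact subset_toMeasurable _ _ fun i _ => (x i).2

lemma IsMeasMajorant.measure_sub_lt_eq_one {Ω : Type*} [MeasurableSpace Ω] {P : Measure Ω}
    [IsProbabilityMeasure P] {f fup : Ω → ℝ} (h : IsMeasMajorant P f fup) {ε : ℝ} (hε : 0 < ε) :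
    P {x | fup x - ε < f x} = 1 := by
  classical
  set A := {x | fup x - ε < f x}
  have hT := measurableSet_toMeasurable P A
  have key := h.2.2 (fun x => if x ∈ toMeasurable P A then fup x else fup x - ε)
    (Measurable.ite hT h.1 (h.1.sub_const ε)) fun x => by
      split_ifs with hx
      · exact h.2.1 x
      · by_contra hc
        exact hx (subset_toMeasurable _ _ (not_le.1 hc))
  rw [← measure_toMeasurable, ← mem_ae_iff_prob_eq_one hT]
  filter_upwards [key] with x hx
  by_contra hc
  rw [if_neg hc] at hx
  linarith

lemma IsMeasMinorant.neg {Ω : Type*} [MeasurableSpace Ω] {P : Measure Ω} {f flow : Ω → ℝ}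
    (h : IsMeasMinorant P f flow) : IsMeasMajorant P (fun x => -f x) (fun x => -flow x) := by
  refine ⟨h.1.neg, fun x => neg_le_neg (h.2.1 x), fun g hg hfg => ?_⟩
  filter_upwards [h.2.2 (fun x => -g x) hg.neg fun x => by linarith [hfg x]] with x hx
  linarith

lemma IsMeasMinorant.measure_lt_add_eq_one {Ω : Type*} [MeasurableSpace Ω] {P : Measure Ω}
    [IsProbabilityMeasure P] {f flow : Ω → ℝ} (h : IsMeasMinorant P f flow) {ε : ℝ}
    (hε : 0 < ε) : P {x | f x < flow x + ε} = 1 := by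
  rw [← h.neg.measure_sub_lt_eq_one hε]
  congr 1
  ext x
  simp only [Set.mem_ofPred_eq]
  constructor <;> intro <;> linarith

lemma IsMeasMajorant.integrable {Ω : Type*} [MeasurableSpace Ω] {P : Measure Ω}
    {f fup fabs : Ω → ℝ} (h : IsMeasMajorant P f fup)
    (habs : IsMeasMajorant P (fun x => |f x|) fabs) (hint : Integrable fabs P) :
    Integrable fup P := by
  refine hint.mono' h.1.aestronglyMeasurable ?_
  filter_upwards [h.2.2 fabs habs.1 fun x => (le_abs_self _).trans (habs.2.1 x)] with x hx
  rw [Real.norm_eq_abs, abs_le]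
  exact ⟨by linarith [neg_abs_le (f x), habs.2.1 x, h.2.1 x], hx⟩

lemma IsMeasMinorant.integrable {Ω : Type*} [MeasurableSpace Ω] {P : Measure Ω}
    {f flow fabs : Ω → ℝ} (h : IsMeasMinorant P f flow)
    (habs : IsMeasMajorant P (fun x => |f x|) fabs) (hint : Integrable fabs P) :
    Integrable flow P := by
  simpa using (h.neg.integrable (by simpa using habs) hint).neg

lemma sum_range_ite_eq_sum_nth (p : ℕ → Prop) [DecidablePred p] (u : ℕ → ℝ) (n : ℕ) :
    ∑ i ∈ Finset.range n, (if p i then u i else 0) =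
      ∑ j ∈ Finset.range (Nat.count p n), u (Nat.nth p j) := by
  induction n with
  | zero => simp
  | succ n ih =>
    rw [Finset.sum_range_succ, ih, Nat.count_succ]
    split_ifs with h
    · rw [Finset.sum_range_succ, Nat.nth_count h]
    · simp

lemma Nat.tendsto_count_atTop {p : ℕ → Prop} [DecidablePred p] (hp : {i | p i}.Infinite) :
    Tendsto (Nat.count p) atTop atTop :=
  tendsto_atTop_atTop_of_monotone (Nat.count_monotone p) fun b =>
    ⟨Nat.nth p b, (Nat.count_nth_of_infinite hp b).ge⟩

/-- The strong law of large numbers for the terms whose index satisfies `p`. -/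
lemma ae_tendsto_sum_ite_sub_count {α : Type*} [MeasurableSpace α] (μ : Measure α)
    [IsProbabilityMeasure μ] {f : α → ℝ} (hf : Measurable f) (hint : Integrable f μ)
    (p : ℕ → Prop) [DecidablePred p] (hp : {i | p i}.Infinite) :
    ∀ᵐ ω ∂(Measure.infinitePi fun _ : ℕ => μ),
      Tendsto (fun n : ℕ => (∑ i ∈ Finset.range n, if p i then f (ω i) else 0) / n -
        (Nat.count p n : ℝ) / n * ∫ x, f x ∂μ) atTop (𝓝 0) := by
  set P := Measure.infinitePi fun _ : ℕ => μ
  have hmp (i : ℕ) : MeasurePreserving (fun ω : ℕ → α => ω i) P μ :=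
    measurePreserving_eval_infinitePi (fun _ : ℕ => μ) i
  have hind : iIndepFun (fun i (ω : ℕ → α) => f (ω i)) P :=
    iIndepFun_infinitePi (fun _ => hf)
  have hslln := strong_law_ae_real (μ := P) (fun j ω => f (ω (Nat.nth p j)))
    ((hmp _).integrable_comp_of_integrable hint)
    (fun i j hij => hind.indepFun fun h => hij (Nat.nth_injective hp h))
    (fun i => ⟨(hf.comp (measurable_pi_apply _)).aemeasurable,
      (hf.comp (measurable_pi_apply _)).aemeasurable, by
      have h (k : ℕ) : P.map (fun ω : ℕ → α => f (ω k)) = μ.map f := by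
        rw [← (hmp k).map_eq, Measure.map_map hf (measurable_pi_apply _)]; rfl
      rw [h, h]⟩)
  have hmean : ∫ ω, f (ω (Nat.nth p 0)) ∂P = ∫ x, f x ∂μ := by
    rw [← (hmp (Nat.nth p 0)).map_eq, integral_map (measurable_pi_apply _).aemeasurable]
    exact hf.aestronglyMeasurable
  filter_upwards [hslln] with ω hω
  rw [hmean] at hω
  have h0 := (tendsto_sub_nhds_zero_iff.2 hω).comp (Nat.tendsto_count_atTop hp)
  refine squeeze_zero_norm (fun n => ?_) (tendsto_zero_iff_norm_tendsto_zero.1 h0)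
  rw [sum_range_ite_eq_sum_nth p (fun i => f (ω i))]
  have hn : (Nat.count p n : ℝ) ≤ n := by exact_mod_cast Nat.count_le p
  have heq : (∑ j ∈ Finset.range (Nat.count p n), f (ω (Nat.nth p j))) / n -
      (Nat.count p n : ℝ) / n * ∫ x, f x ∂μ = (Nat.count p n : ℝ) / n *
      ((∑ j ∈ Finset.range (Nat.count p n), f (ω (Nat.nth p j))) / (Nat.count p n) -
        ∫ x, f x ∂μ) := by
    rcases eq_or_ne (Nat.count p n) 0 with h | h
    · simp [h]
    · have : (Nat.count p n : ℝ) ≠ 0 := by exact_mod_cast h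
      field_simp
  rw [heq, norm_mul]
  refine mul_le_of_le_one_left (norm_nonneg _) ?_
  rw [Real.norm_of_nonneg (by positivity)]
  exact div_le_one_of_le₀ hn (by positivity)

lemma tendsto_average_sub_of_dist_lt {u v : ℕ → ℝ} (h : ∀ i, |u i - v i| ≤ 1 / ((i : ℝ) + 1)) :
    Tendsto (fun n : ℕ => (∑ i ∈ Finset.range n, u i) / n - (∑ i ∈ Finset.range n, v i) / n)
      atTop (𝓝 0) := by
  have h0 : Tendsto (fun i => u i - v i) atTop (𝓝 0) :=
    squeeze_zero_norm h tendsto_one_div_add_atTop_nhds_zero_nat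
  refine h0.cesaro.congr fun n => ?_
  rw [Finset.sum_sub_distrib]
  ring

/-- The numbers whose binary logarithm is even have no asymptotic density. -/
lemma not_tendsto_count_even_log_div (d : ℝ) :
    ¬ Tendsto (fun n : ℕ => (Nat.count (fun i => Even (Nat.log 2 i)) n : ℝ) / n)
      atTop (𝓝 d) := by
  intro h
  set c := Nat.count (fun i => Even (Nat.log 2 i)) with hc
  have hstep (k : ℕ) : c (2 ^ (k + 1)) = c (2 ^ k) + if Even k then 2 ^ k else 0 := by
    have hlog (i : ℕ) (hi : i < 2 ^ k) : Nat.log 2 (2 ^ k + i) = k :=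
      Nat.log_eq_of_pow_le_of_lt_pow (by omega) (by rw [pow_succ]; omega)
    rw [hc, pow_succ, mul_two, Nat.count_add]
    congr 1
    rw [Nat.count_eq_card_filter_range]
    split_ifs with hk
    · rw [Finset.filter_true_of_mem, Finset.card_range]
      intro i hi
      rw [hlog i (Finset.mem_range.1 hi)]
      exact hk
    · rw [Finset.filter_false_of_mem, Finset.card_empty]
      intro i hi
      rw [hlog i (Finset.mem_range.1 hi)]
      exact hk
  have hpow : Tendsto (fun k : ℕ => 2 ^ k) atTop atTop :=
    tendsto_pow_atTop_atTop_of_one_lt (r := 2) (by norm_num)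
  have h1 := h.comp hpow
  have h2 := h1.comp (tendsto_add_atTop_nat 1)
  have h3 : Tendsto (fun k : ℕ => if Even k then (1 : ℝ) else 0) atTop (𝓝 (2 * d - d)) := by
    refine ((h2.const_mul 2).sub h1).congr fun k => ?_
    have hk : (2 : ℝ) ^ k ≠ 0 := by positivity
    simp only [Function.comp_apply, hstep]
    split_ifs <;> push_cast <;> field_simp <;> ring
  have he : Tendsto (fun k : ℕ => 2 * k) atTop atTop :=
    tendsto_id.const_mul_atTop' (by norm_num)
  have ho : Tendsto (fun k : ℕ => 2 * k + 1) atTop atTop := (tendsto_add_atTop_nat 1).comp he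
  have e1 := tendsto_nhds_unique (h3.comp he) (tendsto_const_nhds (x := (1 : ℝ)) |>.congr
    fun k => by simp)
  have e2 := tendsto_nhds_unique (h3.comp ho) (tendsto_const_nhds (x := (0 : ℝ)) |>.congr
    fun k => by simp)
  linarith

lemma infinite_setOf_log_two {q : ℕ → Prop} (hq : ∃ᶠ k in atTop, q k) :
    {i | q (Nat.log 2 i)}.Infinite := by
  have : Function.Injective fun k : ℕ => 2 ^ k := Nat.pow_right_injective le_rfl
  refine ((Nat.frequently_atTop_iff_infinite.1 hq).image this.injOn).mono ?_
  rintro _ ⟨k, hk, rfl⟩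
  simpa [Nat.log_pow] using hk

/-- A set of sequences has full outer measure if it contains almost every sequence along which `f`
is asymptotically equal to its majorant at the indices satisfying `p`, and to its minorant at the
other indices. -/
lemma measure_eq_one_of_ae_of_selection {α : Type*} [MeasurableSpace α] {μ : Measure α}
    [IsProbabilityMeasure μ] {f flow fup : α → ℝ} (hlow : IsMeasMinorant μ f flow)
    (hup : IsMeasMajorant μ f fup) (p : ℕ → Prop) [DecidablePred p] {B : Set (ℕ → α)}
    (hB : ∀ᵐ ω ∂(Measure.infinitePi fun _ : ℕ => μ),
      (∀ i, |f (ω i) - if p i then fup (ω i) else flow (ω i)| ≤ 1 / ((i : ℝ) + 1)) → ω ∈ B) :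
    Measure.infinitePi (fun _ : ℕ => μ) B = 1 := by
  have hpi := infinitePi_univ_pi_eq_one (fun _ : ℕ => μ)
    (A := fun i => {x | |f x - if p i then fup x else flow x| ≤ 1 / ((i : ℝ) + 1)}) fun i => by
      have hε : 0 < 1 / ((i : ℝ) + 1) := by positivity
      refine le_antisymm prob_le_one ?_
      by_cases hi : p i
      · rw [← hup.measure_sub_lt_eq_one hε]
        refine measure_mono fun x hx => ?_
        simp only [Set.mem_ofPred_eq, if_pos hi] at hx ⊢
        rw [abs_le]
        constructor <;> linarith [hup.2.1 x]
      · rw [← hlow.measure_lt_add_eq_one hε]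
        refine measure_mono fun x hx => ?_
        simp only [Set.mem_ofPred_eq, if_neg hi] at hx ⊢
        rw [abs_le]
        constructor <;> linarith [hlow.2.1 x]
  refine le_antisymm prob_le_one (hpi.ge.trans (measure_mono_ae ?_))
  filter_upwards [hB] with ω hω hmem
  exact hω fun i => hmem i (Set.mem_univ i)

/-- In the iidpnmrv setup with integrable minimal measurable majorant of `|Ψ|` and `E_*[X₁] < E^*[X₁]`, the set where `lim Sₙ/n` exists is maximally nonmeasurable. -/
theorem lim_exists_maximally_nonmeasurable
    {Ω₁ : Type*} [MeasurableSpace Ω₁] (P₁ : Measure Ω₁) [IsProbabilityMeasure P₁]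
    (P : Measure (ℕ → Ω₁)) [IsProbabilityMeasure P]
    (hP : IsProjectiveLimit P (fun J : Finset ℕ => Measure.pi (fun _ : J => P₁)))
    (Ψ Ψlow Ψup Ψabs : Ω₁ → ℝ)
    (hΨlow : IsMeasMinorant P₁ Ψ Ψlow)
    (hΨup : IsMeasMajorant P₁ Ψ Ψup)
    (hΨabs : IsMeasMajorant P₁ (fun x => |Ψ x|) Ψabs)
    (hInt : Integrable Ψabs P₁)
    (hlt : (∫ x, Ψlow x ∂P₁) < ∫ x, Ψup x ∂P₁) :
    (∀ B : Set (ℕ → Ω₁), MeasurableSet B →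
        B ⊆ {ω : ℕ → Ω₁ | ∃ l : ℝ, Tendsto (fun n : ℕ => (∑ i ∈ Finset.range n, Ψ (ω i)) / n) atTop (𝓝 l)} → P B = 0) ∧
    (∀ B : Set (ℕ → Ω₁), MeasurableSet B →
        {ω : ℕ → Ω₁ | ∃ l : ℝ, Tendsto (fun n : ℕ => (∑ i ∈ Finset.range n, Ψ (ω i)) / n) atTop (𝓝 l)} ⊆ B → P B = 1) := by
  obtain rfl : P = Measure.infinitePi (fun _ : ℕ => P₁) :=
    hP.unique (Measure.isProjectiveLimit_infinitePi _)
  have hup := hΨup.integrable hΨabs hInt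
  have hlow := hΨlow.integrable hΨabs hInt
  set M := ∫ x, Ψup x ∂P₁
  set m := ∫ x, Ψlow x ∂P₁
  constructor
  · intro B hB hsub
    rw [← prob_compl_eq_one_iff hB]
    let p : ℕ → Prop := fun i => Even (Nat.log 2 i)
    have hp : {i | p i}.Infinite := infinite_setOf_log_two Nat.frequently_even
    have hp' : {i | ¬ p i}.Infinite :=
      infinite_setOf_log_two (q := fun k => ¬ Even k) (by
        simpa only [Nat.not_even_iff_odd] using Nat.frequently_odd)
    refine measure_eq_one_of_ae_of_selection hΨlow hΨup p ?_
    filter_upwards [ae_tendsto_sum_ite_sub_count P₁ hΨup.1 hup p hp,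
      ae_tendsto_sum_ite_sub_count P₁ hΨlow.1 hlow (fun i => ¬ p i) hp'] with ω h1 h2 h3 hω
    obtain ⟨l, hl⟩ := hsub hω
    have h4 := tendsto_average_sub_of_dist_lt h3
    have hMm : M - m ≠ 0 := (sub_pos.2 hlt).ne'
    apply not_tendsto_count_even_log_div ((l - 0 - 0 - 0 - m) / (M - m))
    refine (((((hl.sub h4).sub h1).sub h2).sub_const m).div_const (M - m)).congr' ?_
    filter_upwards [eventually_gt_atTop 0] with n hn
    have hn' : (n : ℝ) ≠ 0 := by positivity
    have hsum : ∑ i ∈ Finset.range n, (if p i then Ψup (ω i) else Ψlow (ω i)) =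
        (∑ i ∈ Finset.range n, if p i then Ψup (ω i) else 0) +
        ∑ i ∈ Finset.range n, if ¬ p i then Ψlow (ω i) else 0 := by
      rw [← Finset.sum_add_distrib]
      refine Finset.sum_congr rfl fun i _ => ?_
      by_cases hi : p i <;> simp [hi]
    have hcount : (Nat.count (fun i => ¬ p i) n : ℝ) = n - Nat.count p n := by
      rw [eq_sub_iff_add_eq']
      simp_rw [Nat.count_eq_card_filter_range]
      exact_mod_cast (Finset.card_filter_add_card_filter_not p).trans (Finset.card_range n)
    rw [hsum, hcount, div_eq_iff hMm]
    change _ = (Nat.count p n : ℝ) / n * (M - m)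
    field_simp
    ring
  · intro B _ hsub
    refine measure_eq_one_of_ae_of_selection hΨlow hΨup (fun _ => True) ?_
    filter_upwards [ae_tendsto_sum_ite_sub_count P₁ hΨup.1 hup (fun _ => True)
      (by simpa using Set.infinite_univ)] with ω h1 h3
    refine hsub ⟨0 + 0 + M, ?_⟩
    refine (((tendsto_average_sub_of_dist_lt h3).add h1).add_const M).congr' ?_
    filter_upwards [eventually_gt_atTop 0] with n hn
    have hn' : (n : ℝ) ≠ 0 := by positivity
    simp only [if_true, Nat.count_true]
    field_simp
    ring
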